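/- arXiv:1109.3502 — 3 statements merged into one kernel-verified Lean document; each statement's English description precedes it below -/
import Mathlib

section
/- Combinatorial Gauß–Bonnet theorem (Theorem 3.5): Let (V, E, F) be a combinatorial triangulated disk datum such that |V| − |E| + |F| = 1 and the number of boundary vertices equals the number of boundary edges. Then (∑_{v a boundary vertex} (4 − deg(v))) + (∑_{v an interior vertex} (6 − deg(v))) = 6, the sums taken in the integers. -/
open scoped Classical

/-- A combinatorial triangulated disk datum: finite sets of vertices, edges
(2-element subsets) and faces (3-element subsets), such that every 2-element
subset of a face is an edge, and every edge lies in exactly one or two faces. -/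
structure DiskDatum (α : Type*) [DecidableEq α] where
  V : Finset α
  E : Finset (Finset α)
  F : Finset (Finset α)
  edge_card : ∀ e ∈ E, e.card = 2
  edge_sub : ∀ e ∈ E, e ⊆ V
  face_card : ∀ f ∈ F, f.card = 3
  face_sub : ∀ f ∈ F, f ⊆ V
  face_edges : ∀ f ∈ F, ∀ e ⊆ f, e.card = 2 → e ∈ E
  edge_faces : ∀ e ∈ E, (F.filter (fun f => e ⊆ f)).card = 1 ∨
      (F.filter (fun f => e ⊆ f)).card = 2

variable {α : Type*} [DecidableEq α]

/-- A boundary edge is an edge contained in exactly one face. -/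
def DiskDatum.IsBoundaryEdge (D : DiskDatum α) (e : Finset α) : Prop :=
  e ∈ D.E ∧ (D.F.filter (fun f => e ⊆ f)).card = 1

/-- A boundary vertex is a vertex lying on some boundary edge. -/
def DiskDatum.IsBoundaryVertex (D : DiskDatum α) (v : α) : Prop :=
  ∃ e, D.IsBoundaryEdge e ∧ v ∈ e

/-- The degree of a vertex is the number of edges containing it. -/
def DiskDatum.deg (D : DiskDatum α) (v : α) : ℕ :=
  (D.E.filter (fun e => v ∈ e)).card

/-- Handshake lemma: the degrees add up to twice the number of edges. -/
theorem DiskDatum.sum_deg (D : DiskDatum α) : ∑ v ∈ D.V, D.deg v = 2 * D.E.card := by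
  have h := Finset.sum_card_bipartiteAbove_eq_sum_card_bipartiteBelow
    (s := D.V) (t := D.E) (fun v e => v ∈ e)
  calc ∑ v ∈ D.V, D.deg v
      = ∑ e ∈ D.E, (D.V.filter (fun v => v ∈ e)).card := by
        simpa [Finset.bipartiteAbove, Finset.bipartiteBelow, DiskDatum.deg] using h
    _ = ∑ e ∈ D.E, 2 := Finset.sum_congr rfl fun e he => by
        rw [Finset.filter_mem_eq_inter, Finset.inter_eq_right.mpr (D.edge_sub e he),
          D.edge_card e he]
    _ = 2 * D.E.card := by rw [Finset.sum_const, smul_eq_mul, mul_comm]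

/-- Every face contains exactly three edges. -/
theorem DiskDatum.card_edges_of_face (D : DiskDatum α) {f : Finset α} (hf : f ∈ D.F) :
    (D.E.filter (fun e => e ⊆ f)).card = 3 := by
  have h : D.E.filter (fun e => e ⊆ f) = f.powersetCard 2 := by
    ext e
    simp only [Finset.mem_filter, Finset.mem_powersetCard]
    exact ⟨fun h => ⟨h.2, D.edge_card e h.1⟩, fun h => ⟨D.face_edges f hf e h.1 h.2, h.1⟩⟩
  rw [h, Finset.card_powersetCard, D.face_card f hf]
  rfl

/-- Counting incidences of edges and faces. -/
theorem DiskDatum.three_mul_card_faces (D : DiskDatum α) :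
    3 * D.F.card + (D.E.filter (fun e => D.IsBoundaryEdge e)).card = 2 * D.E.card := by
  have h := Finset.sum_card_bipartiteAbove_eq_sum_card_bipartiteBelow
    (s := D.E) (t := D.F) (fun e f => e ⊆ f)
  simp only [Finset.bipartiteAbove, Finset.bipartiteBelow] at h
  rw [Finset.sum_congr rfl fun f hf => D.card_edges_of_face hf, Finset.sum_const, smul_eq_mul,
    mul_comm] at h
  rw [← h, Finset.card_filter, ← Finset.sum_add_distrib, mul_comm, ← smul_eq_mul,
    ← Finset.sum_const]
  refine Finset.sum_congr rfl fun e he => ?_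
  rcases D.edge_faces e he with h1 | h2
  · simp [DiskDatum.IsBoundaryEdge, he, h1]
  · simp [DiskDatum.IsBoundaryEdge, h2]

/-- Combinatorial Gauß–Bonnet: for a combinatorial triangulated disk datum with
Euler characteristic 1 whose number of boundary vertices equals its number of
boundary edges, ∑_{v boundary} (4 − deg v) + ∑_{v interior} (6 − deg v) = 6. -/
theorem combinatorial_gauss_bonnet (D : DiskDatum α)
    (euler : (D.V.card : ℤ) - (D.E.card : ℤ) + (D.F.card : ℤ) = 1)
    (hbd : (D.V.filter (fun v => D.IsBoundaryVertex v)).card =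
      (D.E.filter (fun e => D.IsBoundaryEdge e)).card) :
    (∑ v ∈ D.V.filter (fun v => D.IsBoundaryVertex v), (4 - (D.deg v : ℤ))) +
      (∑ v ∈ D.V.filter (fun v => ¬ D.IsBoundaryVertex v), (6 - (D.deg v : ℤ))) = 6 := by
  have hdeg : ∑ v ∈ D.V, (D.deg v : ℤ) = 2 * D.E.card := mod_cast D.sum_deg
  have hfaces := D.three_mul_card_faces
  have hcard := Finset.card_filter_add_card_filter_not (s := D.V) (fun v => D.IsBoundaryVertex v)
  rw [← Finset.sum_filter_add_sum_filter_not D.V (fun v => D.IsBoundaryVertex v)] at hdeg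
  simp only [Finset.sum_sub_distrib, Finset.sum_const, nsmul_eq_mul]
  lia
end

section
/- Corollary 3.7 (combinatorial form): Let (V, E, F) be a combinatorial triangulated disk datum such that |V| − |E| + |F| = 1 and the number of boundary vertices equals the number of boundary edges. If deg(v) ≥ 6 for every interior vertex v, then ∑_{v a boundary vertex} (4 − deg(v)) ≥ 6, the sum taken in the integers. -/
open scoped Classical

variable {α : Type*} [DecidableEq α]

namespace DiskDatum

/-- Handshake identity: the degrees sum to twice the number of edges. -/
theorem sum_deg_s1 (D : DiskDatum α) : ∑ v ∈ D.V, D.deg v = 2 * D.E.card := by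
  have h : ∑ v ∈ D.V, D.deg v = ∑ e ∈ D.E, (D.V.filter (fun v => v ∈ e)).card :=
    Finset.sum_card_bipartiteAbove_eq_sum_card_bipartiteBelow (fun v e => v ∈ e)
  rw [h, Finset.sum_const_nat (m := 2), mul_comm]
  intro e he
  rw [Finset.filter_mem_eq_inter, Finset.inter_eq_right.mpr (D.edge_sub e he), D.edge_card e he]

/-- Each face contains exactly three edges. -/
theorem card_edges_subset_face (D : DiskDatum α) {f : Finset α} (hf : f ∈ D.F) :
    (D.E.filter (fun e => e ⊆ f)).card = 3 := by
  have h : D.E.filter (fun e => e ⊆ f) = f.powersetCard 2 := by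
    ext e
    simp only [Finset.mem_filter, Finset.mem_powersetCard]
    exact ⟨fun ⟨he, hef⟩ => ⟨hef, D.edge_card e he⟩,
      fun ⟨hef, hc⟩ => ⟨D.face_edges f hf e hef hc, hef⟩⟩
  rw [h, Finset.card_powersetCard, D.face_card f hf]
  rfl

/-- Counting edge-face incidences: `3 |F| + |∂E| = 2 |E|`. -/
theorem three_mul_card_faces_add (D : DiskDatum α) :
    3 * D.F.card + (D.E.filter (fun e => D.IsBoundaryEdge e)).card = 2 * D.E.card := by
  have h : ∑ e ∈ D.E, (D.F.filter (fun f => e ⊆ f)).card =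
      ∑ f ∈ D.F, (D.E.filter (fun e => e ⊆ f)).card := by
    simp only [Finset.card_filter]
    exact Finset.sum_comm
  have hF : ∑ f ∈ D.F, (D.E.filter (fun e => e ⊆ f)).card = D.F.card * 3 :=
    Finset.sum_const_nat fun f hf => D.card_edges_subset_face hf
  have hE : ∑ e ∈ D.E, ((D.F.filter (fun f => e ⊆ f)).card +
      if D.IsBoundaryEdge e then 1 else 0) = D.E.card * 2 := by
    refine Finset.sum_const_nat fun e he => ?_
    rcases D.edge_faces e he with h1 | h2
    · simp [IsBoundaryEdge, he, h1]
    · simp [IsBoundaryEdge, h2]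
  rw [Finset.sum_add_distrib, ← Finset.card_filter] at hE
  omega

end DiskDatum

/-- Corollary 3.7 (combinatorial form): if every interior vertex of a
combinatorial triangulated disk datum has degree at least six, then
∑_{v boundary} (4 − deg v) ≥ 6. -/
theorem boundary_curvature_ge_six (D : DiskDatum α)
    (euler : (D.V.card : ℤ) - (D.E.card : ℤ) + (D.F.card : ℤ) = 1)
    (hbd : (D.V.filter (fun v => D.IsBoundaryVertex v)).card =
      (D.E.filter (fun e => D.IsBoundaryEdge e)).card)
    (hint : ∀ v ∈ D.V, ¬ D.IsBoundaryVertex v → 6 ≤ D.deg v) :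
    6 ≤ ∑ v ∈ D.V.filter (fun v => D.IsBoundaryVertex v), (4 - (D.deg v : ℤ)) := by
  have hdeg : ∑ v ∈ D.V, (D.deg v : ℤ) = 2 * D.E.card := by exact_mod_cast D.sum_deg_s1
  have hfaces := D.three_mul_card_faces_add
  have hsplit := Finset.sum_filter_add_sum_filter_not D.V (fun v => D.IsBoundaryVertex v)
    (fun v => 6 - (D.deg v : ℤ))
  have hinterior : ∑ v ∈ D.V.filter (fun v => ¬ D.IsBoundaryVertex v), (6 - (D.deg v : ℤ)) ≤ 0 := by
    refine Finset.sum_nonpos fun v hv => ?_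
    obtain ⟨hvV, hvB⟩ := Finset.mem_filter.mp hv
    have := hint v hvV hvB
    omega
  simp only [Finset.sum_sub_distrib, Finset.sum_const, nsmul_eq_mul] at hsplit hinterior ⊢
  rw [hdeg] at hsplit
  omega
end

section
/- Dihedral angle of a regular simplex (the angle computation used in Theorem 3.11 and Example 6.1): let n ≥ 2 be a natural number and let p₀, p₁, …, pₙ be points in a real inner product space with dist(pᵢ, pⱼ) = 1 for all i ≠ j (the vertices of a regular n-simplex with unit edge lengths). Let c = (1/(n−1)) · ∑_{i=0}^{n−2} pᵢ be the centroid of p₀, …, p_{n−2}. Then the angle ∠ p_{n−1} c pₙ equals arccos(1/n). -/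
/-- If `a` and `b` are at distance `1` from every point of a family of `m` points that are
pairwise at distance `1`, then the inner product of the vectors from the centroid of the family
to `a` and `b` depends only on `m` and `dist a b`. -/
theorem inner_sub_centroid_sub_centroid_of_dist_eq_one {E : Type*} [NormedAddCommGroup E]
    [InnerProductSpace ℝ E] {m : ℕ} (hm : m ≠ 0) (q : Fin m → E)
    (hq : ∀ i j, i ≠ j → dist (q i) (q j) = 1) {a b : E}
    (ha : ∀ i, dist a (q i) = 1) (hb : ∀ i, dist b (q i) = 1) :
    inner ℝ (a - (1 / (m : ℝ)) • ∑ i, q i) (b - (1 / (m : ℝ)) • ∑ i, q i) =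
      (1 - dist a b ^ 2 + 1 / m) / 2 := by
  have hm' : (m : ℝ) ≠ 0 := Nat.cast_ne_zero.2 hm
  have hsub (x : E) : x - (1 / (m : ℝ)) • ∑ i, q i = (1 / (m : ℝ)) • ∑ i, (x - q i) := by
    rw [Finset.sum_sub_distrib, smul_sub, Finset.sum_const, Finset.card_univ, Fintype.card_fin,
      ← Nat.cast_smul_eq_nsmul ℝ, smul_smul, one_div_mul_cancel hm', one_smul]
  have hinner (i j : Fin m) : inner ℝ (a - q i) (b - q j) =
      (1 - dist a b ^ 2) / 2 + if i = j then 1 / 2 else 0 := by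
    have hpolar : inner ℝ (a - q i) (b - q j) =
        (dist a (q j) ^ 2 + dist b (q i) ^ 2 - dist a b ^ 2 - dist (q i) (q j) ^ 2) / 2 := by
      simp only [dist_eq_norm, ← real_inner_self_eq_norm_sq, inner_sub_left, inner_sub_right,
        real_inner_comm]
      rw [real_inner_comm b a, real_inner_comm (q i) b, real_inner_comm (q j) a,
        real_inner_comm (q j) (q i)]
      ring
    rw [hpolar, ha, hb]
    split_ifs with h
    · rw [h, dist_self]; ring
    · rw [hq i j h]; ring
  rw [hsub, hsub, real_inner_smul_left, real_inner_smul_right, sum_inner]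
  simp only [inner_sum, hinner, Finset.sum_add_distrib, Finset.sum_const, Finset.sum_ite_eq,
    Finset.mem_univ, if_true, Finset.card_univ, Fintype.card_fin, nsmul_eq_mul]
  field_simp

/-- Dihedral angle of a regular simplex: if `p₀, …, pₙ` are the vertices of a
regular `n`-simplex with unit edge lengths (`n ≥ 2`) in a real inner product
space, and `c` is the centroid of `p₀, …, p_{n−2}`, then the angle
`∠ p_{n−1} c pₙ` equals `arccos (1 / n)`. -/
theorem regular_simplex_dihedral_angle (n : ℕ) (hn : 2 ≤ n)
    {E : Type*} [NormedAddCommGroup E] [InnerProductSpace ℝ E]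
    (p : Fin (n + 1) → E)
    (hdist : ∀ i j : Fin (n + 1), i ≠ j → dist (p i) (p j) = 1)
    (c : E)
    (hc : c = (1 / ((n : ℝ) - 1)) •
      ∑ i : Fin (n - 1), p (Fin.castLE (by omega) i)) :
    EuclideanGeometry.angle (p ⟨n - 1, by omega⟩) c (p ⟨n, by omega⟩) =
      Real.arccos (1 / n) := by
  obtain ⟨m, rfl⟩ : ∃ m, n = m + 1 := ⟨n - 1, by omega⟩
  have hm : m ≠ 0 := by omega
  have hm' : (m : ℝ) ≠ 0 := Nat.cast_ne_zero.2 hm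
  set q : Fin m → E := fun i ↦ p (Fin.castLE (by omega) i)
  have hc' : c = (1 / (m : ℝ)) • ∑ i, q i := by
    rw [hc]
    push_cast
    rw [add_sub_cancel_right]
    rfl
  set a := p ⟨m + 1 - 1, by omega⟩
  set b := p ⟨m + 1, by omega⟩
  have hqq (i j : Fin m) (h : i ≠ j) : dist (q i) (q j) = 1 :=
    hdist _ _ fun e ↦ h (Fin.castLE_injective _ e)
  have haq (i : Fin m) : dist a (q i) = 1 :=
    hdist _ _ (by simp only [ne_eq, Fin.ext_iff, Fin.val_castLE]; omega)
  have hbq (i : Fin m) : dist b (q i) = 1 :=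
    hdist _ _ (by simp only [ne_eq, Fin.ext_iff, Fin.val_castLE]; omega)
  have hab : dist a b = 1 := hdist _ _ (by simp only [ne_eq, Fin.ext_iff]; omega)
  have hinner := inner_sub_centroid_sub_centroid_of_dist_eq_one hm q hqq haq hbq
  have haa := inner_sub_centroid_sub_centroid_of_dist_eq_one hm q hqq haq haq
  have hbb := inner_sub_centroid_sub_centroid_of_dist_eq_one hm q hqq hbq hbq
  rw [← hc', hab] at hinner
  rw [← hc', dist_self, real_inner_self_eq_norm_sq] at haa hbb
  have hnorm : ‖a - c‖ = ‖b - c‖ :=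
    (sq_eq_sq₀ (norm_nonneg _) (norm_nonneg _)).1 (haa.trans hbb.symm)
  rw [EuclideanGeometry.angle, InnerProductGeometry.angle, vsub_eq_sub, vsub_eq_sub, hinner,
    hnorm, ← sq, hbb]
  congr 1
  push_cast
  have : (m : ℝ) + 1 ≠ 0 := by positivity
  field_simp
  ring
end
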